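/- Let p ≥ 1, n ≥ 1, let g₁,…,g_p and h_{ij} = h_{ji} be holomorphic on an open neighborhood U of 0 in ℂⁿ with g_i(0) = 0, let f = Σ_{i,j=1}^p h_{ij} g_i g_j, and assume the symmetric matrix [H] = (h_{ij}) satisfies det [H(0)] ≠ 0. Then there exist an open neighborhood V ⊆ U of 0 and holomorphic functions g'₁,…,g'_p on V whose germs at 0 generate the same ideal of O_n as the germs of g₁,…,g_p, such that f = q ∘ G' on V, where G' = (g'₁,…,g'_p) : V → ℂ^p and q : ℂ^p → ℂ is the standard quadratic form q(z) = Σ_{i=1}^p z_i². (Corollary 3.4 of the paper.) -/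

import Mathlib

open Filter Topology

set_option maxHeartbeats 1000000
set_option synthInstance.maxHeartbeats 400000

noncomputable section

/-- `ℂⁿ`. -/
abbrev Cn (n : ℕ) : Type := Fin n → ℂ

/-- `Filter.Germ l ℂ` is a `ℂ`-algebra via constant germs. -/
instance germAlgebra {α : Type*} (l : Filter α) : Algebra ℂ (Filter.Germ l ℂ) :=
  ((Filter.Germ.coeRingHom l).comp (Pi.constRingHom α ℂ)).toAlgebra

/-- The local ring `O_n` of germs at `0` of holomorphic functions `ℂⁿ → ℂ`,
realized as the subalgebra of `Filter.Germ (𝓝 0) ℂ` consisting of germs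
having a representative analytic on a neighborhood of `0`. -/
def On (n : ℕ) : Subalgebra ℂ (Filter.Germ (𝓝 (0 : Cn n)) ℂ) where
  carrier := {φ | ∃ f : Cn n → ℂ, AnalyticAt ℂ f 0 ∧ φ = ↑f}
  mul_mem' := by
    rintro a b ⟨f, hf, rfl⟩ ⟨g, hg, rfl⟩
    exact ⟨f * g, hf.mul hg, rfl⟩
  one_mem' := ⟨1, analyticAt_const, rfl⟩
  add_mem' := by
    rintro a b ⟨f, hf, rfl⟩ ⟨g, hg, rfl⟩
    exact ⟨f + g, hf.add hg, rfl⟩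
  zero_mem' := ⟨0, analyticAt_const, rfl⟩
  algebraMap_mem' := fun c => ⟨fun _ => c, analyticAt_const, rfl⟩

/-- The ideal of `O_n` generated by the germs at `0` of a set of functions. -/
def idealOfFuns {n : ℕ} (s : Set (Cn n → ℂ)) : Ideal (On n) :=
  Ideal.span {x : On n | ∃ f ∈ s, (x : Filter.Germ (𝓝 (0 : Cn n)) ℂ) = ↑f}

/-- The `i`-th partial derivative `∂f/∂zᵢ` of `f : ℂⁿ → ℂ`. -/
def pder {n : ℕ} (f : Cn n → ℂ) (i : Fin n) : Cn n → ℂ :=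
  fun z => fderiv ℂ f z (Pi.single i 1)

/-- The jacobian ideal `J(f)` of `O_n`, generated by the germs at `0` of the
partial derivatives of `f`. -/
def jacobianIdeal {n : ℕ} (f : Cn n → ℂ) : Ideal (On n) :=
  idealOfFuns (Set.range (pder f))

/-- For ideals `J ⊆ I` of `O_n`, the quotient `I/J`, realized as the
`ℂ`-subspace of `O_n ⧸ J` given by the image of `I`. -/
def quotIJ {n : ℕ} (I J : Ideal (On n)) : Submodule ℂ ((On n) ⧸ J) :=
  (I.map (Ideal.Quotient.mk J)).restrictScalars ℂ

/-- `f` has a singularity of type `A(d)` at `x ∈ ℂⁿ` (with `r = n - d`):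
there is a biholomorphism `φ` from a neighborhood of `0` in `ℂ^d × ℂ^r` onto a
neighborhood of `x` with `φ 0 = x` and `f (φ (z, w)) - f x = w₁² + ⋯ + w_r²`. -/
def HasAdSingularityAt (n d r : ℕ) (f : Cn n → ℂ) (x : Cn n) : Prop :=
  ∃ (V : Set ((Fin d → ℂ) × (Fin r → ℂ))) (W : Set (Cn n))
    (φ : (Fin d → ℂ) × (Fin r → ℂ) → Cn n) (ψ : Cn n → (Fin d → ℂ) × (Fin r → ℂ)),
    IsOpen V ∧ IsOpen W ∧ (0 : (Fin d → ℂ) × (Fin r → ℂ)) ∈ V ∧ x ∈ W ∧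
    φ 0 = x ∧ AnalyticOnNhd ℂ φ V ∧ AnalyticOnNhd ℂ ψ W ∧
    Set.MapsTo φ V W ∧ Set.MapsTo ψ W V ∧
    (∀ q ∈ V, ψ (φ q) = q) ∧ (∀ y ∈ W, φ (ψ y) = y) ∧
    ∀ q ∈ V, f (φ q) - f x = ∑ i, (q.2 i) ^ 2

open scoped Matrix

/-- A symmetric invertible complex matrix is congruent to the identity. -/
theorem exists_transpose_mul_self_eq {ι : Type*} [Fintype ι] [DecidableEq ι]
    (M : Matrix ι ι ℂ) (hM : M.IsSymm) (hdet : M.det ≠ 0) :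
    ∃ B : Matrix ι ι ℂ, B.transpose * B = M := by
  have hs : ∀ N : Matrix ι ι ℂ, N.IsSymm →
      ∀ x y : ι → ℂ, (Matrix.toLinearMap₂' ℂ N x y : ℂ) = Matrix.toLinearMap₂' ℂ N y x := by
    intro N hN x y
    rw [Matrix.toLinearMap₂'_apply', Matrix.toLinearMap₂'_apply', Matrix.dotProduct_mulVec,
      dotProduct_comm, ← Matrix.mulVec_transpose, hN.eq]
  have hassoc : ∀ N : Matrix ι ι ℂ, N.IsSymm → QuadraticMap.associated (R := ℂ)
      (LinearMap.BilinMap.toQuadraticMap (Matrix.toLinearMap₂' ℂ N)) =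
        Matrix.toLinearMap₂' ℂ N :=
    fun N hN => QuadraticMap.associated_left_inverse ℂ (hs N hN)
  have hsep : ∀ N : Matrix ι ι ℂ, N.IsSymm → N.det ≠ 0 →
      (QuadraticMap.associated (R := ℂ)
        (LinearMap.BilinMap.toQuadraticMap (Matrix.toLinearMap₂' ℂ N))).SeparatingLeft := by
    intro N hN hd
    rw [hassoc N hN]
    exact Matrix.separatingLeft_toLinearMap₂'_iff.mpr
      (Matrix.separatingLeft_iff_det_ne_zero.mpr hd)
  have h1 : (1 : Matrix ι ι ℂ).IsSymm := Matrix.isSymm_one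
  obtain ⟨e⟩ := QuadraticForm.equivalent_of_isAlgClosed _ _ (hsep M hM hdet)
    (hsep 1 h1 (by simp))
  obtain ⟨L, hL⟩ : ∃ L : (ι → ℂ) →ₗ[ℂ] (ι → ℂ), ∀ x,
      (Matrix.toLinearMap₂' ℂ (1 : Matrix ι ι ℂ) (L x) (L x) : ℂ) =
        Matrix.toLinearMap₂' ℂ M x x :=
    ⟨e.toLinearEquiv.toLinearMap, e.map_app⟩
  have he : (Matrix.toLinearMap₂' ℂ (1 : Matrix ι ι ℂ)).compl₁₂ L L =
      Matrix.toLinearMap₂' ℂ M := by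
    rw [← hassoc M hM, ← QuadraticMap.associated_left_inverse ℂ
      (B₁ := (Matrix.toLinearMap₂' ℂ (1 : Matrix ι ι ℂ)).compl₁₂ L L)
      (fun x y => hs 1 h1 _ _)]
    congr 1
    ext x
    exact hL x
  refine ⟨LinearMap.toMatrix' L, ?_⟩
  apply (Matrix.toLinearMap₂' ℂ :
    Matrix ι ι ℂ ≃ₗ[ℂ] (ι → ℂ) →ₗ[ℂ] (ι → ℂ) →ₗ[ℂ] ℂ).injective
  rw [← he]
  have := Matrix.toLinearMap₂'_comp (R := ℂ) (1 : Matrix ι ι ℂ)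
    (LinearMap.toMatrix' L) (LinearMap.toMatrix' L)
  simpa using this.symm

/-- Matrix squaring has an analytic local inverse near the identity. -/
theorem exists_analyticAt_matrix_sqrt (ι : Type*) [Fintype ι] [DecidableEq ι] :
    ∃ s : (ι → ι → ℂ) → ι → ι → ℂ, AnalyticAt ℂ s (Matrix.of.symm 1) ∧
      s (Matrix.of.symm 1) = Matrix.of.symm 1 ∧
      (∀ᶠ M in 𝓝 (Matrix.of.symm 1), Matrix.of (s M) * Matrix.of (s M) = Matrix.of M) ∧
      ∀ᶠ X in 𝓝 (Matrix.of.symm 1), s (Matrix.of.symm (Matrix.of X * Matrix.of X)) = X := by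
  let e : ι → ι → ℂ := Matrix.of.symm 1
  let sq : (ι → ι → ℂ) → ι → ι → ℂ := fun X => Matrix.of.symm (Matrix.of X * Matrix.of X)
  have hsq : sq = fun X i j => ∑ k, X i k * X k j := by
    funext X i j; simp [sq, Matrix.mul_apply]
  have hsqe : sq e = e := by simp [sq, e]
  have hc : ContDiff ℂ ⊤ sq := by
    rw [hsq]; fun_prop
  let d : (ι → ι → ℂ) ≃L[ℂ] (ι → ι → ℂ) :=
    ContinuousLinearEquiv.smulLeft (Units.mk0 (2 : ℂ) two_ne_zero)
  have hd : HasFDerivAt sq (d : (ι → ι → ℂ) →L[ℂ] (ι → ι → ℂ)) e := by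
    rw [hsq]
    refine hasFDerivAt_pi'.2 fun i => hasFDerivAt_pi'.2 fun j => ?_
    have hp : ∀ a b, HasFDerivAt (fun X : ι → ι → ℂ => X a b)
        ((ContinuousLinearMap.proj b).comp
          (ContinuousLinearMap.proj (R := ℂ) (φ := fun _ : ι => ι → ℂ) a)) e :=
      fun a b => ContinuousLinearMap.hasFDerivAt
        ((ContinuousLinearMap.proj b).comp
          (ContinuousLinearMap.proj (R := ℂ) (φ := fun _ : ι => ι → ℂ) a))
    have := HasFDerivAt.fun_sum (u := Finset.univ) fun k _ => (hp i k).mul (hp k j)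
    refine this.congr_fderiv ?_
    ext X
    have he : ∀ a b, e a b = if a = b then 1 else 0 := fun a b => Matrix.one_apply
    simp [d, Finset.sum_add_distrib, two_mul]
    simp [he]
  have hca : ContDiffAt ℂ ⊤ sq e := hc.contDiffAt
  have hs := hca.hasStrictFDerivAt' hd (by simp)
  refine ⟨hca.localInverse hd (by simp), ?_, ?_, ?_, ?_⟩
  · have := (hca.to_localInverse hd (by simp)).analyticAt
    rwa [hsqe] at this
  · have := hca.localInverse_apply_image hd (by simp)
    rwa [hsqe] at this
  · have := hs.eventually_right_inverse
    rw [hsqe] at this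
    exact this
  · exact hs.eventually_left_inverse

/-- A germ of analytic symmetric matrices equal to the identity at the base point has an
analytic symmetric square root. -/
theorem exists_analyticAt_transpose_mul_self_of_eq_one {ι E : Type*} [Fintype ι] [DecidableEq ι]
    [NormedAddCommGroup E] [NormedSpace ℂ E] {M : E → Matrix ι ι ℂ} {x : E}
    (hM : ∀ i j, AnalyticAt ℂ (fun z => M z i j) x) (hsymm : ∀ z, (M z).IsSymm)
    (hx : M x = 1) :
    ∃ S : E → Matrix ι ι ℂ, (∀ i j, AnalyticAt ℂ (fun z => S z i j) x) ∧
      ∀ᶠ z in 𝓝 x, (S z).transpose * S z = M z := by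
  obtain ⟨s, hs, hs1, hr, hl⟩ := exists_analyticAt_matrix_sqrt ι
  let m : E → ι → ι → ℂ := fun z => Matrix.of.symm (M z)
  have hm : AnalyticAt ℂ m x :=
    analyticAt_pi_iff.2 fun i => analyticAt_pi_iff.2 fun j => hM i j
  have hmx : m x = Matrix.of.symm 1 := by simp [m, hx]
  have hsm : AnalyticAt ℂ (fun z => s (m z)) x := by
    rw [← hmx] at hs
    exact hs.comp hm
  have hsij : ∀ i j, AnalyticAt ℂ (fun z => s (m z) i j) x := fun i j =>
    analyticAt_pi_iff.1 (analyticAt_pi_iff.1 hsm i) j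
  have ht : Tendsto (fun z => Matrix.of.symm (Matrix.of (s (m z))).transpose) (𝓝 x)
      (𝓝 (Matrix.of.symm (1 : Matrix ι ι ℂ))) := by
    have : AnalyticAt ℂ (fun z => Matrix.of.symm (Matrix.of (s (m z))).transpose) x :=
      analyticAt_pi_iff.2 fun i => analyticAt_pi_iff.2 fun j => hsij j i
    have := this.continuousAt.tendsto
    simpa [hmx, hs1] using this
  have hmt : Tendsto m (𝓝 x) (𝓝 (Matrix.of.symm (1 : Matrix ι ι ℂ))) := by
    rw [← hmx]; exact hm.continuousAt.tendsto
  refine ⟨fun z => Matrix.of (s (m z)), hsij, ?_⟩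
  filter_upwards [hmt.eventually hr, ht.eventually hl] with z hz1 hz2
  have hz3 : (Matrix.of (s (m z))).transpose = Matrix.of (s (m z)) := by
    have h4 : (Matrix.of (s (m z))).transpose * (Matrix.of (s (m z))).transpose = M z := by
      rw [← Matrix.transpose_mul, hz1]
      exact hsymm z
    rw [Equiv.apply_symm_apply, h4] at hz2
    exact (congrArg Matrix.of hz2).symm
  rw [hz3, hz1]
  rfl

theorem analyticAt_matrix_mul {ι E : Type*} [Fintype ι]
    [NormedAddCommGroup E] [NormedSpace ℂ E] {A B : E → Matrix ι ι ℂ} {x : E}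
    (hA : ∀ i j, AnalyticAt ℂ (fun z => A z i j) x)
    (hB : ∀ i j, AnalyticAt ℂ (fun z => B z i j) x) (i j : ι) :
    AnalyticAt ℂ (fun z => (A z * B z) i j) x := by
  simp only [Matrix.mul_apply]
  exact Finset.analyticAt_fun_sum _ fun k _ => (hA i k).mul (hB k j)

theorem analyticAt_matrix_det {ι E : Type*} [Fintype ι] [DecidableEq ι]
    [NormedAddCommGroup E] [NormedSpace ℂ E] {A : E → Matrix ι ι ℂ} {x : E}
    (hA : ∀ i j, AnalyticAt ℂ (fun z => A z i j) x) :
    AnalyticAt ℂ (fun z => (A z).det) x := by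
  simp only [Matrix.det_apply']
  exact Finset.analyticAt_fun_sum _ fun σ _ =>
    analyticAt_const.mul (Finset.analyticAt_fun_prod _ fun k _ => hA _ _)

theorem analyticAt_matrix_inv {ι E : Type*} [Fintype ι] [DecidableEq ι]
    [NormedAddCommGroup E] [NormedSpace ℂ E] {A : E → Matrix ι ι ℂ} {x : E}
    (hA : ∀ i j, AnalyticAt ℂ (fun z => A z i j) x) (hdet : (A x).det ≠ 0) (i j : ι) :
    AnalyticAt ℂ (fun z => (A z)⁻¹ i j) x := by
  simp only [Matrix.inv_def, Ring.inverse_eq_inv', Matrix.smul_apply, smul_eq_mul,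
    Matrix.adjugate_apply]
  refine ((analyticAt_matrix_det hA).inv hdet).mul (analyticAt_matrix_det fun a b => ?_)
  by_cases h : a = j
  · subst h
    simpa using analyticAt_const
  · simpa [Matrix.updateRow_ne h] using hA a b

/-- A germ of analytic symmetric invertible matrices factors as `Aᵀ * A` with `A` analytic. -/
theorem exists_analyticAt_transpose_mul_self {ι E : Type*} [Fintype ι] [DecidableEq ι]
    [NormedAddCommGroup E] [NormedSpace ℂ E] {H : E → Matrix ι ι ℂ} {x : E}
    (hH : ∀ i j, AnalyticAt ℂ (fun z => H z i j) x) (hsymm : ∀ z, (H z).IsSymm)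
    (hdet : (H x).det ≠ 0) :
    ∃ A : E → Matrix ι ι ℂ, (∀ i j, AnalyticAt ℂ (fun z => A z i j) x) ∧
      (A x).det ≠ 0 ∧ ∀ᶠ z in 𝓝 x, (A z).transpose * A z = H z := by
  obtain ⟨B, hB⟩ := exists_transpose_mul_self_eq (H x) (hsymm x) hdet
  have hBdet : IsUnit B.det := by
    refine isUnit_iff_ne_zero.2 fun h0 => hdet ?_
    rw [← hB, Matrix.det_mul, h0, mul_zero]
  have hBtdet : IsUnit B.transpose.det := by rwa [Matrix.det_transpose]
  obtain ⟨S, hS, hSM⟩ := exists_analyticAt_transpose_mul_self_of_eq_one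
    (M := fun z => B⁻¹.transpose * H z * B⁻¹) (x := x)
    (analyticAt_matrix_mul (analyticAt_matrix_mul (fun _ _ => analyticAt_const) hH)
      fun _ _ => analyticAt_const)
    (fun z => by
      simp only [Matrix.IsSymm, Matrix.transpose_mul, Matrix.transpose_transpose, (hsymm z).eq,
        Matrix.mul_assoc])
    (by
      rw [← hB, Matrix.transpose_nonsing_inv, ← Matrix.mul_assoc,
        Matrix.nonsing_inv_mul _ hBtdet, Matrix.one_mul, Matrix.mul_nonsing_inv _ hBdet])
  have hfac : ∀ᶠ z in 𝓝 x, (S z * B).transpose * (S z * B) = H z := by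
    filter_upwards [hSM] with z hz
    calc (S z * B).transpose * (S z * B)
        = B.transpose * ((S z).transpose * S z) * B := by
          simp only [Matrix.transpose_mul, Matrix.mul_assoc]
      _ = (B.transpose * B.transpose⁻¹) * H z * (B⁻¹ * B) := by
          rw [hz, Matrix.transpose_nonsing_inv]; simp only [Matrix.mul_assoc]
      _ = H z := by
          rw [Matrix.mul_nonsing_inv _ hBtdet, Matrix.nonsing_inv_mul _ hBdet, Matrix.one_mul,
            Matrix.mul_one]
  refine ⟨fun z => S z * B, analyticAt_matrix_mul hS fun _ _ => analyticAt_const, ?_, hfac⟩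
  intro h0
  apply hdet
  rw [← hfac.self_of_nhds, Matrix.det_mul, h0, mul_zero]

/-- Analytic linear combinations of a family generate a smaller ideal. -/
theorem idealOfFuns_range_le {ι κ : Type*} [Fintype κ] {n : ℕ}
    {F : ι → Cn n → ℂ} {G : κ → Cn n → ℂ} {a : ι → κ → Cn n → ℂ}
    (ha : ∀ i j, AnalyticAt ℂ (a i j) 0) (hG : ∀ j, AnalyticAt ℂ (G j) 0)
    (hF : ∀ i, ∀ᶠ z in 𝓝 0, F i z = ∑ j, a i j z * G j z) :
    idealOfFuns (Set.range F) ≤ idealOfFuns (Set.range G) := by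
  refine Ideal.span_le.2 ?_
  rintro y ⟨_, ⟨i, rfl⟩, hy⟩
  let α : κ → On n := fun j => ⟨(a i j : Filter.Germ (𝓝 (0 : Cn n)) ℂ), a i j, ha i j, rfl⟩
  let γ : κ → On n := fun j => ⟨(G j : Filter.Germ (𝓝 (0 : Cn n)) ℂ), G j, hG j, rfl⟩
  have key : y = ∑ j, α j * γ j := by
    apply Subtype.ext
    rw [hy]
    have hsum : ((∑ j, α j * γ j : On n) : Filter.Germ (𝓝 (0 : Cn n)) ℂ) =
        ((∑ j, a i j * G j : Cn n → ℂ) : Filter.Germ (𝓝 (0 : Cn n)) ℂ) := by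
      rw [AddSubmonoidClass.coe_finsetSum]
      exact (map_sum (Filter.Germ.coeRingHom (𝓝 (0 : Cn n))) (fun j => a i j * G j)
        Finset.univ).symm
    rw [hsum]
    refine Filter.Germ.coe_eq.2 ?_
    filter_upwards [hF i] with z hz
    simp [hz]
  rw [key]
  exact Ideal.sum_mem _ fun j _ =>
    Ideal.mul_mem_left _ _ (Ideal.subset_span ⟨G j, ⟨j, rfl⟩, rfl⟩)

/-- **Corollary 3.4.** If `f = Σᵢⱼ hᵢⱼ gᵢ gⱼ` with `[H] = (hᵢⱼ)` symmetric and
`det [H(0)] ≠ 0`, then there are a neighborhood `V ⊆ U` of `0` and holomorphic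
functions `g'₁, …, g'_p` on `V` whose germs at `0` generate the same ideal of
`O_n` as the germs of `g₁, …, g_p`, such that `f = q ∘ G'` on `V`, where
`G' = (g'₁, …, g'_p)` and `q(z) = Σᵢ zᵢ²` is the standard quadratic form. -/
theorem corollary_3_4 (p n : ℕ) (hp : 1 ≤ p) (hn : 1 ≤ n)
    (U : Set (Cn n)) (hU : IsOpen U) (h0U : (0 : Cn n) ∈ U)
    (g : Fin p → Cn n → ℂ) (h : Fin p → Fin p → Cn n → ℂ)
    (hg : ∀ i, AnalyticOnNhd ℂ (g i) U)
    (hh : ∀ i j, AnalyticOnNhd ℂ (h i j) U)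
    (hsymm : ∀ i j, h i j = h j i)
    (hg0 : ∀ i, g i 0 = 0)
    (f : Cn n → ℂ) (hf : ∀ z, f z = ∑ i, ∑ j, h i j z * g i z * g j z)
    (hdet : (Matrix.of fun i j => h i j 0).det ≠ 0)
    (q : (Fin p → ℂ) → ℂ) (hq : q = fun w => ∑ i, (w i) ^ 2) :
    ∃ V : Set (Cn n), V ⊆ U ∧ IsOpen V ∧ (0 : Cn n) ∈ V ∧
      ∃ g' : Fin p → Cn n → ℂ,
        (∀ i, AnalyticOnNhd ℂ (g' i) V) ∧
        idealOfFuns (Set.range g) = idealOfFuns (Set.range g') ∧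
        (∀ z ∈ V, f z = q (fun i => g' i z)) := by
  subst hq
  obtain ⟨A, hA, hAdet, hAH⟩ := exists_analyticAt_transpose_mul_self
    (H := fun z => Matrix.of fun i j => h i j z) (x := (0 : Cn n))
    (fun i j => hh i j 0 h0U)
    (fun z => by ext i j; exact congrFun (hsymm j i) z) hdet
  let g' : Fin p → Cn n → ℂ := fun i z => ∑ j, A z i j * g j z
  have hg'z : ∀ z, (fun i => g' i z) = A z *ᵥ fun j => g j z := fun z => rfl
  have hg' : ∀ i, AnalyticAt ℂ (g' i) 0 := fun i =>
    Finset.analyticAt_fun_sum _ fun j _ => (hA i j).mul (hg j 0 h0U)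
  have hdetz : ∀ᶠ z in 𝓝 (0 : Cn n), (A z).det ≠ 0 :=
    (analyticAt_matrix_det hA).continuousAt.eventually_ne hAdet
  obtain ⟨V, hV, hVo, h0V⟩ := eventually_nhds_iff.1
    ((hU.eventually_mem h0U).and
      ((eventually_all.2 fun i => (hg' i).eventually_analyticAt).and hAH))
  refine ⟨V, fun z hz => (hV z hz).1, hVo, h0V, g', fun i z hz => (hV z hz).2.1 i, ?_, ?_⟩
  · apply le_antisymm
    · refine idealOfFuns_range_le (a := fun i j z => (A z)⁻¹ i j)
        (analyticAt_matrix_inv hA hAdet) hg' fun i => ?_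
      filter_upwards [hdetz] with z hz
      have : (A z)⁻¹ *ᵥ (fun i => g' i z) = fun j => g j z := by
        rw [hg'z, Matrix.mulVec_mulVec, Matrix.nonsing_inv_mul _ (isUnit_iff_ne_zero.2 hz),
          Matrix.one_mulVec]
      exact (congrFun this i).symm
    · exact idealOfFuns_range_le (a := fun i j z => A z i j) hA (fun j => hg j 0 h0U)
        fun i => Eventually.of_forall fun z => rfl
  · intro z hz
    have hH := (hV z hz).2.2
    let v : Fin p → ℂ := fun j => g j z
    calc f z = v ⬝ᵥ ((Matrix.of fun i j => h i j z) *ᵥ v) := by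
          rw [hf]
          simp only [dotProduct, Matrix.mulVec, Finset.mul_sum, Matrix.of_apply, v]
          exact Finset.sum_congr rfl fun i _ => Finset.sum_congr rfl fun j _ => by ring
      _ = (A z *ᵥ v) ⬝ᵥ (A z *ᵥ v) := by
          rw [← hH, ← Matrix.mulVec_mulVec, Matrix.dotProduct_mulVec, Matrix.vecMul_transpose]
      _ = ∑ i, (g' i z) ^ 2 := by
          simp only [dotProduct, sq]; rfl


end
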